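/- Pointwise complexity bound for the optimality residual of GFB (exact case): under the setting of the previous statement with the exact GFB iteration z_i^{k+1} = z_i^k + λ_k(u_i^{k+1} − x^k), x^k = Σ_i ω_i z_i^k, and writing g^k = (1/γ)x^k − ∇f(x^k) − (1/γ)Σ_i ω_i u_i^{k+1}, if ∇f is (1/β)-Lipschitz, γ ∈ (0, 2β), and λ_k ∈ [1/(2α), 1/α) is non-decreasing with α = 2β/(4β−γ), then ‖g^k + ∇f(Σ_i ω_i u_i^{k+1})‖ ≤ (1/γ)·d₀/√(τ_k(k+1)), where τ_k = λ_k(1/α − λ_k) and d₀ is the distance of the initial point z⁰ in the weighted product space to a fixed point of the GFB fixed-point operator. -/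

import Mathlib

open scoped RealInnerProductSpace

section Gradient

variable {H : Type*} [NormedAddCommGroup H] [InnerProductSpace ℝ H] [CompleteSpace H]
  {f : H → ℝ} {gradf : H → H}

theorem HasGradientAt.hasDerivAt_line {g x d : H} {t : ℝ} (hg : HasGradientAt f g (x + t • d)) :
    HasDerivAt (fun s : ℝ => f (x + s • d)) ⟪g, d⟫ t := by
  have hline : HasDerivAt (fun s : ℝ => x + s • d) d t := by
    simpa using ((hasDerivAt_id t).smul_const d).const_add x
  exact (hg.hasFDerivAt.comp_hasDerivAt t hline).congr_deriv (by simp)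

theorem ConvexOn.add_inner_gradient_le (hf : ConvexOn ℝ Set.univ f) {g x : H}
    (hg : HasGradientAt f g x) (y : H) : f x + ⟪g, y - x⟫ ≤ f y := by
  have hconv : ConvexOn ℝ Set.univ (fun s : ℝ => f (x + s • (y - x))) := by
    simpa [Function.comp_def, AffineMap.lineMap_apply, add_comm] using
      hf.comp_affineMap (AffineMap.lineMap x y : ℝ →ᵃ[ℝ] H)
  have hderiv := HasGradientAt.hasDerivAt_line (f := f) (g := g) (x := x) (d := y - x) (t := 0)
    (by simpa using hg)
  have h := hconv.le_slope_of_hasDerivAt (Set.mem_univ _) (Set.mem_univ _) zero_lt_one hderiv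
  simp [slope_def_field] at h
  linarith

theorem descent_of_gradient_bound {L : ℝ} (hgrad : ∀ x, HasGradientAt f (gradf x) x)
    (hL : ∀ x y, ‖gradf x - gradf y‖ ≤ L * ‖x - y‖) (x d : H) :
    f (x + d) ≤ f x + ⟪gradf x, d⟫ + L / 2 * ‖d‖ ^ 2 := by
  have hquad (t : ℝ) : HasDerivAt (fun s : ℝ => f x + s * ⟪gradf x, d⟫ + L / 2 * ‖d‖ ^ 2 * s ^ 2)
      (⟪gradf x, d⟫ + L * ‖d‖ ^ 2 * t) t := by
    refine ((((hasDerivAt_id t).mul_const ⟪gradf x, d⟫).const_add (f x)).add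
      ((hasDerivAt_pow 2 t).const_mul (L / 2 * ‖d‖ ^ 2))).congr_deriv ?_
    push_cast
    ring
  have hline (t : ℝ) := (hgrad (x + t • d)).hasDerivAt_line
  have h := image_le_of_deriv_right_le_deriv_boundary (a := 0) (b := 1)
    (fun t _ => (hline t).continuousAt.continuousWithinAt)
    (fun t _ => (hline t).hasDerivWithinAt) (by simp)
    (fun t _ => (hquad t).continuousAt.continuousWithinAt)
    (fun t _ => (hquad t).hasDerivWithinAt)
    (fun t ht => by
      have h1 := real_inner_le_norm (gradf (x + t • d) - gradf x) d
      have h2 := hL (x + t • d) x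
      rw [add_sub_cancel_left, norm_smul, Real.norm_of_nonneg ht.1] at h2
      rw [inner_sub_left] at h1
      nlinarith [mul_le_mul_of_nonneg_right h2 (norm_nonneg d)])
    (Set.right_mem_Icc.2 zero_le_one)
  simpa using h

/-- Half of the **Baillon–Haddad** inequality. -/
theorem ConvexOn.add_inner_gradient_add_sq_le {β : ℝ} (hβ : 0 < β) (hf : ConvexOn ℝ Set.univ f)
    (hgrad : ∀ x, HasGradientAt f (gradf x) x)
    (hL : ∀ x y, ‖gradf x - gradf y‖ ≤ 1 / β * ‖x - y‖) (x y : H) :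
    f x + ⟪gradf x, y - x⟫ + β / 2 * ‖gradf x - gradf y‖ ^ 2 ≤ f y := by
  set w := gradf x - gradf y with hw
  have h1 := hf.add_inner_gradient_le (hgrad x) (y + β • w)
  have h2 := descent_of_gradient_bound hgrad hL y (β • w)
  have h3 : ⟪gradf x, w⟫ - ⟪gradf y, w⟫ = ‖w‖ ^ 2 := by
    rw [← inner_sub_left, ← hw, real_inner_self_eq_norm_sq]
  have h4 : 1 / β / 2 * (β * ‖w‖) ^ 2 = β / 2 * ‖w‖ ^ 2 := by field_simp
  rw [norm_smul, Real.norm_of_nonneg hβ.le, inner_smul_right, h4] at h2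
  rw [add_sub_right_comm, inner_add_right, inner_smul_right] at h1
  linear_combination h1 + h2 - β * h3

/-- The **Baillon–Haddad theorem**: a Lipschitz gradient of a convex function is cocoercive. -/
theorem ConvexOn.gradient_cocoercive {β : ℝ} (hβ : 0 < β) (hf : ConvexOn ℝ Set.univ f)
    (hgrad : ∀ x, HasGradientAt f (gradf x) x)
    (hL : ∀ x y, ‖gradf x - gradf y‖ ≤ 1 / β * ‖x - y‖) (x y : H) :
    β * ‖gradf x - gradf y‖ ^ 2 ≤ ⟪gradf x - gradf y, x - y⟫ := by
  have h1 := hf.add_inner_gradient_add_sq_le hβ hgrad hL x y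
  have h2 := hf.add_inner_gradient_add_sq_le hβ hgrad hL y x
  rw [norm_sub_rev] at h2
  rw [← neg_sub x y, inner_neg_right] at h1
  rw [inner_sub_left]
  linarith

end Gradient

section InnerProductSpace

variable {H : Type*} [NormedAddCommGroup H] [InnerProductSpace ℝ H]

theorem ConvexOn.inner_sub_prox_le {φ : H → ℝ} {c : ℝ} (hc : 0 ≤ c) (hφ : ConvexOn ℝ Set.univ φ)
    {y p : H} (hp : ∀ w, (1 / 2) * ‖y - p‖ ^ 2 + c * φ p ≤ (1 / 2) * ‖y - w‖ ^ 2 + c * φ w)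
    (w : H) : ⟪y - p, w - p⟫ ≤ c * (φ w - φ p) := by
  have hstep (t : ℝ) (ht : 0 < t) (ht1 : t ≤ 1) :
      ⟪y - p, w - p⟫ ≤ c * (φ w - φ p) + t * (1 / 2 * ‖w - p‖ ^ 2) := by
    have h1 := hp (p + t • (w - p))
    have h2 := hφ.2 (Set.mem_univ p) (Set.mem_univ w) (sub_nonneg.2 ht1) ht.le (by ring)
    rw [show (1 - t) • p + t • w = p + t • (w - p) by module, smul_eq_mul, smul_eq_mul] at h2
    rw [← sub_sub, norm_sub_sq_real (y - p), inner_smul_right, norm_smul, Real.norm_of_nonneg ht.le] at h1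
    refine le_of_mul_le_mul_left ?_ ht
    linear_combination h1 + c * h2
  have hcont : Continuous fun t : ℝ => c * (φ w - φ p) + t * (1 / 2 * ‖w - p‖ ^ 2) := by
    fun_prop
  have hlim := (hcont.tendsto 0).mono_left (nhdsWithin_le_nhds (s := Set.Ioi 0))
  rw [zero_mul, add_zero] at hlim
  refine ge_of_tendsto hlim ?_
  filter_upwards [Ioc_mem_nhdsGT (zero_lt_one (α := ℝ))] with t ht using hstep t ht.1 ht.2

theorem ConvexOn.prox_firmlyNonexpansive {φ : H → ℝ} {c : ℝ} (hc : 0 ≤ c)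
    (hφ : ConvexOn ℝ Set.univ φ) {P : H → H}
    (hP : ∀ y w, (1 / 2) * ‖y - P y‖ ^ 2 + c * φ (P y) ≤ (1 / 2) * ‖y - w‖ ^ 2 + c * φ w)
    (v w : H) : 0 ≤ ⟪P v - P w, (v - w) - (P v - P w)⟫ := by
  have h1 := hφ.inner_sub_prox_le hc (hP v) (P w)
  have h2 := hφ.inner_sub_prox_le hc (hP w) (P v)
  have h3 : ⟪P v - P w, (v - w) - (P v - P w)⟫
      = -⟪v - P v, P w - P v⟫ - ⟪w - P w, P v - P w⟫ := by
    simp only [inner_sub_left, inner_sub_right, real_inner_comm]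
    ring
  linarith

theorem norm_sub_smul_le_of_cocoercive {β γ : ℝ} (hγ : 0 ≤ γ) (hγβ : γ ≤ 2 * β) {x g : H}
    (h : β * ‖g‖ ^ 2 ≤ ⟪g, x⟫) : ‖x - γ • g‖ ≤ ‖x‖ := by
  rw [← sq_le_sq₀ (norm_nonneg _) (norm_nonneg _), norm_sub_sq_real, inner_smul_right,
    real_inner_comm, norm_smul, Real.norm_of_nonneg hγ]
  nlinarith [mul_nonneg hγ (sub_nonneg.2 h),
    mul_nonneg (mul_nonneg hγ (sub_nonneg.2 hγβ)) (sq_nonneg ‖g‖)]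

/-- Pointwise complexity of the relaxed fixed-point iteration `z (k + 1) = z k - lam k • e k`, with
residuals `e k` that are `c`-cocoercive along the orbit. -/
theorem mul_norm_sq_le_of_cocoercive_residual {c : ℝ} {lam : ℕ → ℝ} (hmono : Monotone lam)
    (hc : 0 < c) (hlam : ∀ k, lam k ∈ Set.Ico c (2 * c)) {z e : ℕ → H} {zstar : H}
    (hz : ∀ k, z (k + 1) = z k - lam k • e k)
    (hstar : ∀ k, c * ‖e k‖ ^ 2 ≤ ⟪e k, z k - zstar⟫)
    (hcoc : ∀ k, c * ‖e k - e (k + 1)‖ ^ 2 ≤ ⟪e k - e (k + 1), z k - z (k + 1)⟫) (k : ℕ) :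
    (lam k * (2 * c - lam k)) * (k + 1) * ‖e k‖ ^ 2 ≤ ‖z 0 - zstar‖ ^ 2 := by
  have hpos (k) : 0 < lam k := hc.trans_le (hlam k).1
  have hfejer (k) : ‖z (k + 1) - zstar‖ ^ 2 + lam k * (2 * c - lam k) * ‖e k‖ ^ 2
      ≤ ‖z k - zstar‖ ^ 2 := by
    rw [hz, sub_right_comm, norm_sub_sq_real, inner_smul_right, real_inner_comm, norm_smul,
      Real.norm_of_nonneg (hpos k).le]
    nlinarith [mul_le_mul_of_nonneg_left (hstar k) (hpos k).le]
  have hanti (k) : ‖e (k + 1)‖ ^ 2 ≤ ‖e k‖ ^ 2 := by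
    have h1 := hcoc k
    rw [hz, sub_sub_cancel, inner_smul_right, inner_sub_left, real_inner_self_eq_norm_sq] at h1
    have h2 := norm_sub_sq_real (e k) (e (k + 1))
    rw [real_inner_comm] at h1
    have h3 := mul_nonneg (sub_nonneg.2 (hlam k).2.le) (sq_nonneg ‖e k - e (k + 1)‖)
    refine le_of_mul_le_mul_left ?_ (hpos k)
    linear_combination 2 * h1 + h3 - lam k * h2
  have htau (k) : lam (k + 1) * (2 * c - lam (k + 1)) ≤ lam k * (2 * c - lam k) := by
    nlinarith [hmono k.le_succ, (hlam k).1, (hlam (k + 1)).1]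
  have htau_nonneg (k) : 0 ≤ lam k * (2 * c - lam k) :=
    mul_nonneg (hpos k).le (sub_nonneg.2 (hlam k).2.le)
  have hmain : (lam k * (2 * c - lam k)) * (k + 1) * ‖e k‖ ^ 2 + ‖z (k + 1) - zstar‖ ^ 2
      ≤ ‖z 0 - zstar‖ ^ 2 := by
    induction k with
    | zero => simpa [add_comm] using hfejer 0
    | succ k ih =>
      have h1 := mul_le_mul (htau k) (hanti k) (sq_nonneg _) (htau_nonneg k)
      have h2 := mul_le_mul_of_nonneg_left h1 (by positivity : (0 : ℝ) ≤ k + 1)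
      push_cast
      linear_combination h2 + hfejer (k + 1) + ih
  linarith [sq_nonneg ‖z (k + 1) - zstar‖]

end InnerProductSpace

section WeightedProduct

variable {H : Type*} [NormedAddCommGroup H] [InnerProductSpace ℝ H] {ι : Type*} [Fintype ι]

/-- The map sending `Hⁿ` with the weighted inner product `∑ i, ω i * ⟪x i, y i⟫`
to the Euclidean product. -/
noncomputable def weightedEmbedding (ω : ι → ℝ) : (ι → H) →ₗ[ℝ] PiLp 2 (fun _ : ι => H) where
  toFun z := WithLp.toLp 2 fun i => √(ω i) • z i
  map_add' x y := by ext i; simp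
  map_smul' c x := by ext i; simp [smul_comm c]

theorem inner_weightedEmbedding {ω : ι → ℝ} (hω : ∀ i, 0 ≤ ω i) (x y : ι → H) :
    ⟪weightedEmbedding ω x, weightedEmbedding ω y⟫ = ∑ i, ω i * ⟪x i, y i⟫ := by
  simp only [weightedEmbedding, LinearMap.coe_mk, AddHom.coe_mk, PiLp.inner_apply,
    real_inner_smul_left, real_inner_smul_right, ← mul_assoc, Real.mul_self_sqrt (hω _)]

theorem norm_sq_weightedEmbedding {ω : ι → ℝ} (hω : ∀ i, 0 ≤ ω i) (x : ι → H) :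
    ‖weightedEmbedding ω x‖ ^ 2 = ∑ i, ω i * ‖x i‖ ^ 2 := by
  simp only [← real_inner_self_eq_norm_sq, inner_weightedEmbedding hω]

theorem norm_sq_sum_smul_le {ω : ι → ℝ} (hω : ∀ i, 0 ≤ ω i) (hωs : ∑ i, ω i = 1) (x : ι → H) :
    ‖∑ i, ω i • x i‖ ^ 2 ≤ ∑ i, ω i * ‖x i‖ ^ 2 := by
  have hconv : ConvexOn ℝ Set.univ fun v : H => ‖v‖ ^ 2 :=
    (convexOn_norm convex_univ).pow (fun _ _ => norm_nonneg _) 2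
  exact hconv.map_sum_le (fun i _ => hω i) hωs fun _ _ => Set.mem_univ _

/-- Cocoercivity of the residual of the generalized forward-backward operator, in terms of the
differences `z` of the arguments, `g` of the gradients and `p` of the proximal points. -/
theorem gfb_residual_cocoercive {ω : ι → ℝ} (hω : ∀ i, 0 ≤ ω i) (hωs : ∑ i, ω i = 1)
    {β γ : ℝ} (hβ : 0 < β) (hγ : 0 ≤ γ) {z p : ι → H} {m g : H} (hm : m = ∑ i, ω i • z i)
    (hg : β * ‖g‖ ^ 2 ≤ ⟪g, m⟫)
    (hp : ∀ i, 0 ≤ ⟪p i, ((2 : ℝ) • m - z i - γ • g) - p i⟫) :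
    (1 - γ / (4 * β)) * ∑ i, ω i * ‖m - p i‖ ^ 2 ≤ ∑ i, ω i * ⟪m - p i, z i⟫ := by
  set s := ∑ i, ω i • (m - p i) with hs
  have hexpand (i) : ⟪p i, ((2 : ℝ) • m - z i - γ • g) - p i⟫ =
      ‖m‖ ^ 2 - ⟪m, z i⟫ - γ * ⟪g, m⟫ - ‖m - p i‖ ^ 2 + ⟪m - p i, z i⟫ + γ * ⟪m - p i, g⟫ := by
    simp only [← real_inner_self_eq_norm_sq, inner_sub_left, inner_sub_right, inner_smul_right,
      real_inner_comm g m, real_inner_comm (p i) m]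
    ring
  have hsum := Finset.sum_nonneg fun i (_ : i ∈ Finset.univ) => mul_nonneg (hω i) (hp i)
  have hmz : ∑ i, ω i * ⟪m, z i⟫ = ‖m‖ ^ 2 := by
    simp_rw [← inner_smul_right]
    rw [← inner_sum, ← hm, real_inner_self_eq_norm_sq]
  have hsg : ∑ i, ω i * ⟪m - p i, g⟫ = ⟪s, g⟫ := by
    simp only [hs, sum_inner, real_inner_smul_left]
  have htotal : ∑ i, ω i * ⟪p i, ((2 : ℝ) • m - z i - γ • g) - p i⟫ =
      -γ * ⟪g, m⟫ - ∑ i, ω i * ‖m - p i‖ ^ 2 + ∑ i, ω i * ⟪m - p i, z i⟫ + γ * ⟪s, g⟫ := by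
    simp_rw [hexpand, mul_add, mul_sub, Finset.sum_add_distrib, Finset.sum_sub_distrib,
      ← Finset.sum_mul, hωs, hmz]
    simp_rw [mul_left_comm (ω _) γ, ← Finset.mul_sum, hsg]
    ring
  rw [htotal] at hsum
  have hyoung : ⟪s, g⟫ ≤ β * ‖g‖ ^ 2 + 1 / (4 * β) * ‖s‖ ^ 2 := by
    refine (real_inner_le_norm s g).trans (sub_nonneg.1 ?_)
    have : β * ‖g‖ ^ 2 + 1 / (4 * β) * ‖s‖ ^ 2 - ‖s‖ * ‖g‖
        = 1 / (4 * β) * (‖s‖ - 2 * β * ‖g‖) ^ 2 := by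
      field_simp
      ring
    rw [this]
    positivity
  have hjensen : 1 / (4 * β) * ‖s‖ ^ 2 ≤ 1 / (4 * β) * ∑ i, ω i * ‖m - p i‖ ^ 2 :=
    mul_le_mul_of_nonneg_left (norm_sq_sum_smul_le hω hωs _) (by positivity)
  linear_combination hsum + γ * hyoung + γ * hjensen + γ * hg

end WeightedProduct

open scoped RealInnerProductSpace

theorem gfb_pointwise_complexity
    {H : Type*} [NormedAddCommGroup H] [InnerProductSpace ℝ H] [CompleteSpace H]
    (n : ℕ) (ω : Fin n → ℝ) (hω : ∀ i, ω i ∈ Set.Ioc (0:ℝ) 1) (hωs : ∑ i, ω i = 1)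
    (β γ : ℝ) (hβ : 0 < β) (hγ : γ ∈ Set.Ioo (0:ℝ) (2*β))
    (f : H → ℝ) (hf : ConvexOn ℝ Set.univ f)
    (gradf : H → H) (hgrad : ∀ x, HasGradientAt f (gradf x) x)
    (hlip : LipschitzWith (Real.toNNReal (1/β)) gradf)
    (h : Fin n → H → ℝ) (hconv : ∀ i, ConvexOn ℝ Set.univ (h i))
    (P : Fin n → H → H)
    (hP : ∀ i y w, (1/2) * ‖y - P i y‖^2 + (γ/ω i) * h i (P i y) ≤
                   (1/2) * ‖y - w‖^2 + (γ/ω i) * h i w)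
    (α : ℝ) (hα : α = 2*β/(4*β - γ))
    (lam : ℕ → ℝ) (hlam : ∀ k, lam k ∈ Set.Ico (1/(2*α)) (1/α)) (hmono : Monotone lam)
    (T : (Fin n → H) → (Fin n → H))
    (hT : ∀ z i, T z i =
      z i + P i ((2:ℝ) • (∑ j, ω j • z j) - z i - γ • gradf (∑ j, ω j • z j))
          - (∑ j, ω j • z j))
    (zstar : Fin n → H) (hzs : T zstar = zstar)
    (z : ℕ → Fin n → H)
    (hz : ∀ k, z (k+1) = fun i => z k i + lam k • (T (z k) i - z k i))
    (x : ℕ → H) (hx : ∀ k, x k = ∑ i, ω i • z k i)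
    (u : ℕ → Fin n → H)
    (hu : ∀ k i, u (k+1) i = P i ((2:ℝ) • x k - z k i - γ • gradf (x k)))
    (g : ℕ → H)
    (hg : ∀ k, g k = (1/γ) • x k - gradf (x k) - (1/γ) • (∑ i, ω i • u (k+1) i))
    (d₀ : ℝ) (hd₀ : d₀ = Real.sqrt (∑ i, ω i * ‖z 0 i - zstar i‖^2))
    (τ : ℕ → ℝ) (hτ : ∀ k, τ k = lam k * (1/α - lam k)) :
    ∀ k, ‖g k + gradf (∑ i, ω i • u (k+1) i)‖ ≤
      (1/γ) * (d₀ / Real.sqrt (τ k * (k+1))) := by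
  obtain ⟨hγ0, hγ2⟩ := hγ
  have hω0 (i) : 0 ≤ ω i := (hω i).1.le
  have hL (x y) : ‖gradf x - gradf y‖ ≤ 1 / β * ‖x - y‖ := by
    simpa [hβ.le] using hlip.norm_sub_le x y
  have hcoc := hf.gradient_cocoercive hβ hgrad hL
  set c := 1 - γ / (4 * β) with hc
  have hαc : 1 / α = 2 * c := by
    rw [hα, hc]
    field_simp
    ring
  have hαc' : 1 / (2 * α) = c := by
    rw [one_div, mul_inv, ← one_div α, hαc]
    ring
  have hcpos : 0 < c := by
    rw [hc, sub_pos, div_lt_one (by positivity)]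
    linarith
  simp_rw [hαc, hαc'] at hlam hτ
  have hres (y w : Fin n → H) : c * ∑ i, ω i * ‖(y - T y) i - (w - T w) i‖ ^ 2 ≤
      ∑ i, ω i * ⟪(y - T y) i - (w - T w) i, (y - w) i⟫ := by
    have h1 := gfb_residual_cocoercive hω0 hωs hβ hγ0.le (z := y - w)
      (m := (∑ j, ω j • y j) - ∑ j, ω j • w j)
      (by simp [smul_sub]) (hcoc _ _)
      (fun i => by
        convert (hconv i).prox_firmlyNonexpansive (div_pos hγ0 (hω i).1).le (hP i)
          ((2 : ℝ) • (∑ j, ω j • y j) - y i - γ • gradf (∑ j, ω j • y j))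
          ((2 : ℝ) • (∑ j, ω j • w j) - w i - γ • gradf (∑ j, ω j • w j)) using 3
        simp only [Pi.sub_apply]
        module)
    have hdiff (i) : (y - T y) i - (w - T w) i = (∑ j, ω j • y j) - (∑ j, ω j • w j)
        - (P i ((2 : ℝ) • (∑ j, ω j • y j) - y i - γ • gradf (∑ j, ω j • y j))
          - P i ((2 : ℝ) • (∑ j, ω j • w j) - w i - γ • gradf (∑ j, ω j • w j))) := by
      simp only [Pi.sub_apply, hT]
      abel
    simpa only [hdiff] using h1
  let J := weightedEmbedding (H := H) ω
  have hresJ (y w : Fin n → H) :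
      c * ‖J (y - T y) - J (w - T w)‖ ^ 2 ≤ ⟪J (y - T y) - J (w - T w), J y - J w⟫ := by
    simpa only [J, ← map_sub, norm_sq_weightedEmbedding hω0, inner_weightedEmbedding hω0,
      Pi.sub_apply] using hres y w
  intro k
  have hrate := mul_norm_sq_le_of_cocoercive_residual hmono hcpos hlam
    (z := fun k => J (z k)) (e := fun k => J (z k - T (z k))) (zstar := J zstar)
    (fun k => by
      rw [← map_smul, ← map_sub, hz]
      congr 1
      ext i
      simp only [Pi.sub_apply, Pi.smul_apply]
      module)
    (fun k => by simpa [hzs] using hresJ (z k) zstar)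
    (fun k => hresJ _ _) k
  rw [← hτ, ← map_sub, norm_sq_weightedEmbedding hω0, norm_sq_weightedEmbedding hω0] at hrate
  have hsub (i) : (z k - T (z k)) i = x k - u (k + 1) i := by
    rw [Pi.sub_apply, hT, hu, hx]
    abel
  have hmean : x k - ∑ i, ω i • u (k + 1) i = ∑ i, ω i • (z k - T (z k)) i := by
    simp only [hsub, smul_sub, Finset.sum_sub_distrib, ← Finset.sum_smul, hωs, one_smul]
  have hτpos : 0 < τ k * (k + 1) := by
    rw [hτ]
    exact mul_pos (mul_pos (hcpos.trans_le (hlam k).1) (sub_pos.2 (hlam k).2)) (by positivity)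
  have hbound : ‖x k - ∑ i, ω i • u (k + 1) i‖ ≤ d₀ / √(τ k * (k + 1)) := by
    rw [hd₀, ← Real.sqrt_div' _ hτpos.le]
    refine Real.le_sqrt_of_sq_le ?_
    rw [le_div_iff₀' hτpos, hmean]
    exact (mul_le_mul_of_nonneg_left (norm_sq_sum_smul_le hω0 hωs _) hτpos.le).trans hrate
  have hg' : g k + gradf (∑ i, ω i • u (k + 1) i) = (1 / γ) • ((x k - ∑ i, ω i • u (k + 1) i)
      - γ • (gradf (x k) - gradf (∑ i, ω i • u (k + 1) i))) := by
    rw [hg, smul_sub (1 / γ) _ (γ • _), smul_smul, one_div_mul_cancel hγ0.ne']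
    module
  rw [hg', norm_smul, Real.norm_of_nonneg (by positivity)]
  gcongr
  exact (norm_sub_smul_le_of_cocoercive hγ0.le hγ2.le (hcoc _ _)).trans hbound
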